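/- arXiv:0908.3173 — 2 statements merged into one kernel-verified Lean document; each statement's English description precedes it below -/
import Mathlib

section
/- (Bonatti's lemma, ambient version.) For every η > 0, every N ∈ ℕ, and every ℓ ≥ 1, there exists ε > 0 such that the following holds: if f_1, f_2, …, f_N : ℝ^ℓ → ℝ^ℓ are C¹ maps with ‖f_i(x) − x‖ + ‖D_x f_i − Id‖ < ε for every x ∈ ℝ^ℓ and every 1 ≤ i ≤ N, then for every x ∈ ℝ^ℓ, ‖(f_1 ∘ f_2 ∘ ⋯ ∘ f_N)(x) − x − Σ_{i=1}^N (f_i(x) − x)‖ ≤ η · max_{1 ≤ i ≤ N} ‖f_i(x) − x‖. -/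
/-- A composition of maps whose differences with the identity are `ε`-Lipschitz, `ε ≤ 1`, displaces
a point by the sum of the individual displacements up to an error of order `ε`. -/
theorem norm_foldr_comp_sub_sub_sum_le {E : Type*} [SeminormedAddCommGroup E] {ε M : ℝ} (hε : 0 ≤ ε)
    (hε1 : ε ≤ 1) (hM : 0 ≤ M) (x : E) (L : List (E → E))
    (hL : ∀ g ∈ L, ∀ y z, ‖(g y - y) - (g z - z)‖ ≤ ε * ‖y - z‖)
    (hLM : ∀ g ∈ L, ‖g x - x‖ ≤ M) :
    ‖L.foldr (· ∘ ·) id x - x - (L.map fun g => g x - x).sum‖ ≤ ε * 4 ^ L.length * M := by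
  induction L with
  | nil => simpa using mul_nonneg hε hM
  | cons g L ih =>
    simp only [List.mem_cons, forall_eq_or_imp] at hL hLM
    have ih := ih hL.2 hLM.2
    simp only [List.foldr_cons, Function.comp_apply, List.map_cons, List.sum_cons,
      List.length_cons]
    set y := L.foldr (· ∘ ·) id x
    set S := (L.map fun g => g x - x).sum with hS_def
    have hS : ‖S‖ ≤ L.length * M := by
      have := List.sum_le_card_nsmul (L.map fun g => ‖g x - x‖) M (by simpa using hLM.2)
      rw [List.length_map, nsmul_eq_mul] at this
      refine le_trans ?_ this
      rw [hS_def, ← Multiset.sum_coe]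
      simpa [Function.comp_def] using
        norm_multiset_sum_le ((L.map fun g => g x - x : List E) : Multiset E)
    have hy : ‖y - x‖ ≤ ε * 4 ^ L.length * M + L.length * M := by
      calc ‖y - x‖ = ‖(y - x - S) + S‖ := by rw [sub_add_cancel]
        _ ≤ _ := norm_add_le_of_le ih hS
    have hlen : (L.length : ℝ) ≤ 4 ^ L.length := by
      exact_mod_cast (Nat.lt_pow_self (by norm_num : 1 < 4)).le
    have hy' : ‖y - x‖ ≤ 4 ^ L.length * M + 4 ^ L.length * M := by
      refine hy.trans (add_le_add ?_ (by gcongr))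
      rw [mul_assoc]
      exact mul_le_of_le_one_left (by positivity) hε1
    calc ‖g y - x - (g x - x + S)‖ = ‖((g y - y) - (g x - x)) + (y - x - S)‖ := by
          congr 1; abel
      _ ≤ ε * (4 ^ L.length * M + 4 ^ L.length * M) + ε * 4 ^ L.length * M :=
          norm_add_le_of_le ((hL.1 y x).trans (by gcongr)) ih
      _ ≤ ε * 4 ^ (L.length + 1) * M := by
          have : 0 ≤ ε * 4 ^ L.length * M := by positivity
          rw [pow_succ]
          linarith

/-- If the derivative of `f` is everywhere `ε`-close to the identity, then `f - id` is
`ε`-Lipschitz. -/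
theorem norm_sub_self_sub_le_of_norm_fderiv_sub_id_le {E : Type*} [NormedAddCommGroup E]
    [NormedSpace ℝ E] {f : E → E} {ε : ℝ} (hf : Differentiable ℝ f)
    (h : ∀ x, ‖fderiv ℝ f x - ContinuousLinearMap.id ℝ E‖ ≤ ε) (y z : E) :
    ‖(f y - y) - (f z - z)‖ ≤ ε * ‖y - z‖ :=
  convex_univ.norm_image_sub_le_of_norm_hasFDerivWithin_le
    (fun x _ => ((hf x).hasFDerivAt.sub (hasFDerivAt_id x)).hasFDerivWithinAt)
    (fun x _ => h x) (Set.mem_univ z) (Set.mem_univ y)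


/-- Bonatti's lemma (ambient version). For every `η > 0`, `N`, and `ℓ ≥ 1`,
there is `ε > 0` such that if `f 1, …, f N` are `C¹` maps of ℝ^ℓ that are ε-close to the
identity in the `C¹` sense, then the displacement of the composition `f 1 ∘ ⋯ ∘ f N` at any
point differs from the sum of the individual displacements by at most `η` times the largest
individual displacement. -/
theorem bonatti_lemma (η : ℝ) (hη : 0 < η) (N ℓ : ℕ) (hℓ : 1 ≤ ℓ) :
    ∃ ε > (0 : ℝ),
      ∀ f : Fin N → (EuclideanSpace ℝ (Fin ℓ) → EuclideanSpace ℝ (Fin ℓ)),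
        (∀ i, ContDiff ℝ 1 (f i)) →
        (∀ i x, ‖f i x - x‖ +
            ‖fderiv ℝ (f i) x - ContinuousLinearMap.id ℝ (EuclideanSpace ℝ (Fin ℓ))‖ < ε) →
        ∀ x, ‖(List.ofFn f).foldr (· ∘ ·) id x - x - ∑ i, (f i x - x)‖ ≤
            η * ⨆ i, ‖f i x - x‖ := by
  refine ⟨min 1 (η / 4 ^ N), by positivity, fun f hf h x => ?_⟩
  have hM : 0 ≤ ⨆ i, ‖f i x - x‖ := Real.iSup_nonneg fun i => norm_nonneg _
  have key := norm_foldr_comp_sub_sub_sum_le (ε := min 1 (η / 4 ^ N)) (by positivity)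
    (min_le_left _ _) hM x (List.ofFn f)
    (List.forall_mem_ofFn_iff.2 fun i => norm_sub_self_sub_le_of_norm_fderiv_sub_id_le
      ((hf i).differentiable one_ne_zero)
      fun z => (le_add_of_nonneg_left (norm_nonneg _)).trans (h i z).le)
    (List.forall_mem_ofFn_iff.2 fun i =>
      le_ciSup (f := fun i => ‖f i x - x‖) (Set.finite_range _).bddAbove i)
  rw [List.map_ofFn, List.sum_ofFn, List.length_ofFn] at key
  refine key.trans (mul_le_mul_of_nonneg_right ?_ hM)
  exact (le_div_iff₀ (by positivity)).1 (min_le_right _ _)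
end

section
/- Let A be an n × n integer matrix, k ≥ 1, η > 0, and let f, g_1, …, g_n be C¹ diffeomorphisms of E = ℝ^ℓ. For x ∈ E let D(x) denote the n × ℓ matrix whose i-th row is g_i(x) − x. Assume: (i) ‖D_x(f^k) − Id‖ ≤ η for every x ∈ E; (ii) ‖f^k(g_i(x)) − f^k(x) − D_x(f^k)(g_i(x) − x)‖ ≤ η ‖g_i(x) − x‖ for every x ∈ E and every i; (iii) for every y ∈ E and every i, ‖(∏_{j=1}^n g_j^{(A^k)_{ij}})(y) − y − Σ_{j=1}^n (A^k)_{ij} (g_j(y) − y)‖ ≤ η · max_j ‖g_j(y) − y‖; and (iv) f^k ∘ g_i = (∏_{j=1}^n g_j^{(A^k)_{ij}}) ∘ f^k for every i. Then for every x ∈ E, setting y = f^k(x), for every column index 1 ≤ j ≤ ℓ: ‖col_j(D(x)) − A^k · col_j(D(y))‖ ≤ η √(nℓ) · ( 2 max_{j'} ‖col_{j'}(D(x))‖ + max_{j'} ‖col_{j'}(D(y))‖ ), where A^k · col_j(D(y)) is the matrix–vector product in ℝ^n. -/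
/-- The `j`-th column of the `n × ℓ` displacement matrix `D(x)` whose `i`-th row is
`g i x − x`, as a vector of `ℝ^n` with the Euclidean norm. -/
noncomputable def dispCol {n ℓ : ℕ} (g : Fin n → Equiv.Perm (EuclideanSpace ℝ (Fin ℓ)))
    (x : EuclideanSpace ℝ (Fin ℓ)) (j : Fin ℓ) : EuclideanSpace ℝ (Fin n) :=
  (WithLp.equiv 2 (Fin n → ℝ)).symm (fun i => (g i x - x) j)

/-- A Euclidean norm is at most the square root of the dimension times a bound on the
coordinates. -/
lemma EuclideanSpace.norm_le_sqrt_mul_of_abs_le {m : ℕ} (v : EuclideanSpace ℝ (Fin m)) {C : ℝ}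
    (hC : 0 ≤ C) (h : ∀ i, |v i| ≤ C) : ‖v‖ ≤ Real.sqrt m * C := by
  rw [EuclideanSpace.norm_eq, ← Real.sqrt_sq hC, ← Real.sqrt_mul (Nat.cast_nonneg m)]
  refine Real.sqrt_le_sqrt ?_
  calc ∑ i, ‖v i‖ ^ 2 ≤ ∑ _i : Fin m, C ^ 2 :=
        Finset.sum_le_sum fun i _ => pow_le_pow_left₀ (norm_nonneg _) (h i) 2
    _ = m * C ^ 2 := by simp

/-- Every displacement is controlled by the largest column of the displacement matrix. -/
lemma norm_sub_le_sqrt_mul_iSup_dispCol {n ℓ : ℕ}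
    (g : Fin n → Equiv.Perm (EuclideanSpace ℝ (Fin ℓ))) (x : EuclideanSpace ℝ (Fin ℓ))
    (i : Fin n) : ‖g i x - x‖ ≤ Real.sqrt ℓ * ⨆ j, ‖dispCol g x j‖ :=
  EuclideanSpace.norm_le_sqrt_mul_of_abs_le _ (Real.iSup_nonneg fun _ => norm_nonneg _) fun j =>
    (PiLp.norm_apply_le (dispCol g x j) i).trans
      (le_ciSup (f := fun j => ‖dispCol g x j‖) (Set.finite_range _).bddAbove j)

/-- The columns of the displacement matrix `D(x)` are close to the image under
`A ^ k` of the corresponding columns of `D(f^k x)`, with error `η √(nℓ)` times the listed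
column maxima. -/
theorem displacement_along_orbit {n ℓ : ℕ}
    (A : Matrix (Fin n) (Fin n) ℤ) (k : ℕ) (hk : 1 ≤ k) (η : ℝ) (hη : 0 < η)
    (f : Equiv.Perm (EuclideanSpace ℝ (Fin ℓ)))
    (g : Fin n → Equiv.Perm (EuclideanSpace ℝ (Fin ℓ)))
    (hf : ContDiff ℝ 1 ⇑f) (hf' : ContDiff ℝ 1 ⇑f.symm)
    (hg : ∀ i, ContDiff ℝ 1 ⇑(g i)) (hg' : ∀ i, ContDiff ℝ 1 ⇑(g i).symm)
    (h1 : ∀ x, ‖fderiv ℝ (⇑(f ^ k)) x -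
        ContinuousLinearMap.id ℝ (EuclideanSpace ℝ (Fin ℓ))‖ ≤ η)
    (h2 : ∀ i x, ‖(f ^ k) (g i x) - (f ^ k) x - fderiv ℝ (⇑(f ^ k)) x (g i x - x)‖ ≤
        η * ‖g i x - x‖)
    (h3 : ∀ y i, ‖(List.ofFn fun j => g j ^ ((A ^ k) i j)).prod y - y -
        ∑ j, ((A ^ k) i j : ℝ) • (g j y - y)‖ ≤ η * ⨆ j, ‖g j y - y‖)
    (h4 : ∀ i, f ^ k * g i = (List.ofFn fun j => g j ^ ((A ^ k) i j)).prod * f ^ k) :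
    ∀ x, ∀ j : Fin ℓ,
      ‖dispCol g x j -
          Matrix.toEuclideanLin ((A.map (Int.cast : ℤ → ℝ)) ^ k) (dispCol g ((f ^ k) x) j)‖ ≤
        η * Real.sqrt (n * ℓ) *
          (2 * (⨆ j', ‖dispCol g x j'‖) + ⨆ j', ‖dispCol g ((f ^ k) x) j'‖) := by
  intro x j
  set y := (f ^ k) x with hy
  set Mx := ⨆ j', ‖dispCol g x j'‖
  set My := ⨆ j', ‖dispCol g y j'‖
  have hMx : 0 ≤ Mx := Real.iSup_nonneg fun _ => norm_nonneg _
  have hMy : 0 ≤ My := Real.iSup_nonneg fun _ => norm_nonneg _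
  have hrow : ∀ i, ‖(g i x - x) - ∑ j, ((A ^ k) i j : ℝ) • (g j y - y)‖ ≤
      η * Real.sqrt ℓ * (2 * Mx + My) := by
    intro i
    have : Nonempty (Fin n) := ⟨i⟩
    have hx : ‖g i x - x‖ ≤ Real.sqrt ℓ * Mx := norm_sub_le_sqrt_mul_iSup_dispCol g x i
    have hsup : ⨆ j, ‖g j y - y‖ ≤ Real.sqrt ℓ * My :=
      ciSup_le fun i => norm_sub_le_sqrt_mul_iSup_dispCol g y i
    have e1 := (fderiv ℝ (⇑(f ^ k)) x - ContinuousLinearMap.id ℝ _).le_of_opNorm_le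
      (h1 x) (g i x - x)
    have e2 := h2 i x
    have e3 := h3 y i
    have hconj : (f ^ k) (g i x) = (List.ofFn fun j => g j ^ ((A ^ k) i j)).prod y := by
      simpa using congrArg (fun p : Equiv.Perm _ => p x) (h4 i)
    rw [← hconj] at e3
    have hsplit : (g i x - x) - ∑ j, ((A ^ k) i j : ℝ) • (g j y - y) =
        ((f ^ k) (g i x) - y - ∑ j, ((A ^ k) i j : ℝ) • (g j y - y)) -
        ((f ^ k) (g i x) - (f ^ k) x - fderiv ℝ (⇑(f ^ k)) x (g i x - x)) -
        (fderiv ℝ (⇑(f ^ k)) x - ContinuousLinearMap.id ℝ (EuclideanSpace ℝ (Fin ℓ)))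
          (g i x - x) := by
      rw [← hy, sub_apply, ContinuousLinearMap.id_apply]
      abel
    rw [hsplit]
    refine (norm_sub_le _ _).trans ((add_le_add_left (norm_sub_le _ _) _).trans ?_)
    have hx' := mul_le_mul_of_nonneg_left hx hη.le
    have hsup' := mul_le_mul_of_nonneg_left hsup hη.le
    linarith
  have hpow : A.map (Int.cast : ℤ → ℝ) ^ k = (A ^ k).map (Int.cast : ℤ → ℝ) :=
    (map_pow (Int.castRingHom ℝ).mapMatrix A k).symm
  have hentry : ∀ i, |(dispCol g x j - Matrix.toEuclideanLin (A.map (Int.cast : ℤ → ℝ) ^ k)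
      (dispCol g y j)) i| ≤ η * Real.sqrt ℓ * (2 * Mx + My) := by
    intro i
    refine le_of_eq_of_le ?_ ((PiLp.norm_apply_le _ j).trans (hrow i))
    rw [hpow, Real.norm_eq_abs]
    simp [dispCol, Matrix.toLpLin_apply, Matrix.mulVec, dotProduct]
  refine (EuclideanSpace.norm_le_sqrt_mul_of_abs_le _ (by positivity) hentry).trans_eq ?_
  rw [Real.sqrt_mul (Nat.cast_nonneg n)]
  ring
end
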